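/- Let 𝔤 be a 7-dimensional real Lie algebra admitting an abelian almost 3-contact structure (φ_i, ξ_i, η_i), i = 1,2,3. Then the endomorphism ψ of the 4-dimensional horizontal subspace 𝔥 is either zero or invertible. -/

import Mathlib

/-- `(i,j,k)` is an even permutation of `(1,2,3)` (indexed here as `(0,1,2)`). -/
def evenPerm (i j k : Fin 3) : Prop :=
  (i, j, k) = ((0 : Fin 3), (1 : Fin 3), (2 : Fin 3)) ∨
  (i, j, k) = ((1 : Fin 3), (2 : Fin 3), (0 : Fin 3)) ∨
  (i, j, k) = ((2 : Fin 3), (0 : Fin 3), (1 : Fin 3))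

/-- An abelian almost 3-contact structure on a real Lie algebra `L`: three almost
contact structures `(φ i, ξ i, η i)` satisfying the quaternionic-like compatibility
relations for every even permutation `(i,j,k)` of `(1,2,3)`, each of which is abelian. -/
structure AbelianAC3 (L : Type*) [LieRing L] [LieAlgebra ℝ L] where
  φ : Fin 3 → (L →ₗ[ℝ] L)
  ξ : Fin 3 → L
  η : Fin 3 → (L →ₗ[ℝ] ℝ)
  acs : ∀ i, ∀ x : L, φ i (φ i x) = -x + η i x • ξ i
  unit : ∀ i, η i (ξ i) = 1
  comp_phi : ∀ i j k, evenPerm i j k → ∀ x : L, φ k x = φ i (φ j x) - η j x • ξ i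
  comp_phi' : ∀ i j k, evenPerm i j k → ∀ x : L, φ k x = -φ j (φ i x) + η i x • ξ j
  comp_xi : ∀ i j k, evenPerm i j k → φ i (ξ j) = ξ k
  comp_xi' : ∀ i j k, evenPerm i j k → φ j (ξ i) = -ξ k
  comp_eta : ∀ i j k, evenPerm i j k → ∀ x : L, η i (φ j x) = η k x
  comp_eta' : ∀ i j k, evenPerm i j k → ∀ x : L, η j (φ i x) = -η k x
  abelian_ad : ∀ i, ∀ x : L, ⁅ξ i, φ i x⁆ = φ i ⁅ξ i, x⁆
  abelian_br : ∀ i, ∀ X Y : L, η i X = 0 → η i Y = 0 → ⁅φ i X, φ i Y⁆ = ⁅X, Y⁆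

namespace AbelianAC3

variable {L : Type*} [LieRing L] [LieAlgebra ℝ L]

/-- Membership in the horizontal subspace `𝔥 = ⋂ ker (η i)`. -/
def inH (S : AbelianAC3 L) (x : L) : Prop := ∀ i, S.η i x = 0

/-- The horizontal subspace `𝔥` as a submodule. -/
def H (S : AbelianAC3 L) : Submodule ℝ L :=
  LinearMap.ker (S.η 0) ⊓ LinearMap.ker (S.η 1) ⊓ LinearMap.ker (S.η 2)

/-- The vertical subspace `𝔳 = span{ξ₁, ξ₂, ξ₃}`. -/
def V (S : AbelianAC3 L) : Submodule ℝ L :=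
  Submodule.span ℝ {S.ξ 0, S.ξ 1, S.ξ 2}

/-- The endomorphism `ψ(X) = [ξ₁, φ₁ X]` (as a linear map on all of `L`). -/
def psi (S : AbelianAC3 L) : L →ₗ[ℝ] L :=
  (LieAlgebra.ad ℝ L (S.ξ 0)) ∘ₗ (S.φ 0)

/-- The distinguished horizontal vector `𝒵 = φ₁([ξ₂, ξ₃])`. -/
def Z (S : AbelianAC3 L) : L := S.φ 0 ⁅S.ξ 1, S.ξ 2⁆

end AbelianAC3

namespace AbelianAC3

variable {L : Type*} [LieRing L] [LieAlgebra ℝ L] (S : AbelianAC3 L)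

theorem mem_H {x : L} : x ∈ S.H ↔ S.inH x := by
  simp [H, inH, Fin.forall_fin_succ, and_assoc]

theorem evenPerm_succ (i : Fin 3) : evenPerm i (i + 1) (i + 2) := by
  fin_cases i <;> simp [evenPerm]

theorem φ_ξ (i : Fin 3) : S.φ i (S.ξ i) = 0 := by
  have h0 : S.φ i (S.φ i (S.ξ i)) = 0 := by simp [S.acs, S.unit]
  have h1 : S.φ i (S.ξ i) = S.η i (S.φ i (S.ξ i)) • S.ξ i := by
    have h := S.acs i (S.φ i (S.ξ i))
    rw [h0, map_zero] at h
    exact (neg_add_eq_zero.mp h.symm)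
  rw [h1, map_smul, h1, smul_smul] at h0
  have hc := congrArg (S.η i) h0
  simp only [map_smul, S.unit, map_zero, smul_eq_mul, mul_one, mul_self_eq_zero] at hc
  rw [h1, hc, zero_smul]

theorem η_φ (i : Fin 3) (x : L) : S.η i (S.φ i x) = 0 := by
  have h := S.acs i (S.φ i x)
  rw [S.acs i x, map_add, map_neg, map_smul, S.φ_ξ, smul_zero] at h
  have hc := congrArg (S.η i) (add_left_cancel h).symm
  simpa [S.unit] using hc

theorem η_ξ_of_ne {i j : Fin 3} (h : i ≠ j) : S.η i (S.ξ j) = 0 := by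
  have key (i j k : Fin 3) (hp : evenPerm i j k) :
      S.η i (S.ξ k) = 0 ∧ S.η j (S.ξ k) = 0 := by
    constructor
    · rw [← S.comp_xi i j k hp, S.η_φ]
    · rw [← neg_neg (S.ξ k), ← S.comp_xi' i j k hp, map_neg, S.η_φ, neg_zero]
  have h0 := key _ _ _ (evenPerm_succ 0)
  have h1 := key _ _ _ (evenPerm_succ 1)
  have h2 := key _ _ _ (evenPerm_succ 2)
  fin_cases i <;> fin_cases j <;> simp_all

variable {S} in
theorem inH.φ {x : L} (hx : S.inH x) (j : Fin 3) : S.inH (S.φ j x) := by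
  have key (i j k : Fin 3) (hp : evenPerm i j k) :
      S.η i (S.φ j x) = 0 ∧ S.η j (S.φ i x) = 0 := by
    rw [S.comp_eta i j k hp, S.comp_eta' i j k hp, hx k]
    simp
  have h0 := key _ _ _ (evenPerm_succ 0)
  have h1 := key _ _ _ (evenPerm_succ 1)
  have h2 := key _ _ _ (evenPerm_succ 2)
  intro i
  by_cases hij : i = j
  · rw [hij, S.η_φ]
  · fin_cases i <;> fin_cases j <;> simp_all

theorem lie_ξ_φ_eq_of_evenPerm {i j k : Fin 3} (hp : evenPerm i j k) {x : L}
    (hx : S.inH x) : ⁅S.ξ k, S.φ k x⁆ = ⁅S.ξ j, S.φ j x⁆ := by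
  rw [S.comp_phi i j k hp x, hx j, zero_smul, sub_zero, ← S.comp_xi i j k hp]
  refine S.abelian_br i _ _ (S.η_ξ_of_ne ?_) (hx.φ j i)
  rcases hp with h | h | h <;> simp only [Prod.mk.injEq] at h <;> simp [h]

theorem psi_eq (i : Fin 3) {x : L} (hx : S.inH x) : S.psi x = ⁅S.ξ i, S.φ i x⁆ := by
  have h0 := S.lie_ξ_φ_eq_of_evenPerm (evenPerm_succ 0) hx
  have h1 := S.lie_ξ_φ_eq_of_evenPerm (evenPerm_succ 1) hx
  fin_cases i
  · rfl
  · simpa [psi] using h1.trans h0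
  · simpa [psi] using h1

theorem psi_inH {x : L} (hx : S.inH x) : S.inH (S.psi x) := fun i => by
  rw [S.psi_eq i hx, S.abelian_ad, S.η_φ]

theorem psi_φ (i : Fin 3) {x : L} (hx : S.inH x) : S.psi (S.φ i x) = S.φ i (S.psi x) := by
  rw [S.psi_eq i (hx.φ i), S.psi_eq i hx, S.abelian_ad]

theorem linearIndependent_quaternionic_orbit {x : L} (hx : S.inH x) (hx0 : x ≠ 0) :
    LinearIndependent ℝ ![x, S.φ 0 x, S.φ 1 x, S.φ 2 x] := by
  rw [Fintype.linearIndependent_iff]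
  intro c hc
  simp only [Fin.sum_univ_four, Matrix.cons_val] at hc
  have sq (i : Fin 3) : S.φ i (S.φ i x) = -x := by simp [S.acs, hx i]
  have comp (i : Fin 3) : S.φ i (S.φ (i + 1) x) = S.φ (i + 2) x := by
    simp [S.comp_phi i _ _ (evenPerm_succ i) x, hx (i + 1)]
  have comp' (i : Fin 3) : S.φ (i + 1) (S.φ i x) = -S.φ (i + 2) x := by
    simp [S.comp_phi' i _ _ (evenPerm_succ i) x, hx i]
  have c0 : S.φ 0 (S.φ 1 x) = S.φ 2 x := comp 0
  have c1 : S.φ 1 (S.φ 2 x) = S.φ 0 x := comp 1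
  have c2 : S.φ 2 (S.φ 0 x) = S.φ 1 x := comp 2
  have d0 : S.φ 1 (S.φ 0 x) = -S.φ 2 x := comp' 0
  have d1 : S.φ 2 (S.φ 1 x) = -S.φ 0 x := comp' 1
  have d2 : S.φ 0 (S.φ 2 x) = -S.φ 1 x := comp' 2
  have norm_smul : (c 0 ^ 2 + c 1 ^ 2 + c 2 ^ 2 + c 3 ^ 2) • x = 0 := by
    have e0 := congrArg (S.φ 0) hc
    have e1 := congrArg (S.φ 1) hc
    have e2 := congrArg (S.φ 2) hc
    simp only [map_add, map_smul, map_zero, sq, c0, c1, c2, d0, d1, d2] at e0 e1 e2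
    linear_combination (norm := module) c 0 • hc - c 1 • e0 - c 2 • e1 - c 3 • e2
  have hn := (smul_eq_zero.mp norm_smul).resolve_right hx0
  intro i
  have : c i ^ 2 ≤ 0 := by
    fin_cases i <;> simp <;> nlinarith [sq_nonneg (c 0), sq_nonneg (c 1), sq_nonneg (c 2),
      sq_nonneg (c 3)]
  exact pow_eq_zero_iff two_ne_zero |>.mp (le_antisymm this (sq_nonneg _))

theorem finrank_H_add_three [FiniteDimensional ℝ L] :
    Module.finrank ℝ S.H + 3 = Module.finrank ℝ L := by
  have hker : S.H = LinearMap.ker (LinearMap.pi S.η) := by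
    ext x
    simp [mem_H, inH, funext_iff]
  have hsurj : Function.Surjective (LinearMap.pi S.η) := by
    intro c
    refine ⟨∑ i, c i • S.ξ i, funext fun j => ?_⟩
    rw [LinearMap.pi_apply, map_sum, Finset.sum_eq_single j]
    · simp [S.unit]
    · intro i _ hij
      simp [S.η_ξ_of_ne hij.symm]
    · simp
  have h := (LinearMap.pi S.η).finrank_range_add_finrank_ker
  rw [LinearMap.range_eq_top.mpr hsurj, finrank_top, Module.finrank_fin_fun, ← hker] at h
  omega

theorem psi_eq_zero_of_finrank_eq_seven [FiniteDimensional ℝ L] (hdim : Module.finrank ℝ L = 7)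
    {x : L} (hx : S.inH x) (hx0 : x ≠ 0) (hψ : S.psi x = 0) {y : L} (hy : S.inH y) :
    S.psi y = 0 := by
  have hspan : Submodule.span ℝ (Set.range ![x, S.φ 0 x, S.φ 1 x, S.φ 2 x]) ≤
      S.H ⊓ LinearMap.ker S.psi := by
    rw [Submodule.span_le, Set.range_subset_iff]
    intro i
    fin_cases i <;> simp [S.mem_H, hx, hx.φ, S.psi_φ, hψ]
  have hcard := finrank_span_eq_card (S.linearIndependent_quaternionic_orbit hx hx0)
  rw [Fintype.card_fin] at hcard
  have hle := Submodule.finrank_mono hspan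
  have hH := S.finrank_H_add_three
  have heq : S.H ⊓ LinearMap.ker S.psi = S.H :=
    Submodule.eq_of_le_of_finrank_le inf_le_left (by omega)
  exact LinearMap.mem_ker.mp (inf_eq_left.mp heq (S.mem_H.mpr hy))

end AbelianAC3

/-- on a 7-dimensional Lie algebra with abelian almost 3-contact
structure, the endomorphism `ψ` of `𝔥` is either zero or invertible. -/
theorem AbelianAC3.psi_zero_or_invertible_dim7
    {L : Type*} [LieRing L] [LieAlgebra ℝ L] [FiniteDimensional ℝ L]
    (hdim : Module.finrank ℝ L = 7)
    (S : AbelianAC3 L) :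
    (∀ X : L, S.inH X → S.psi X = 0) ∨
    ((∀ X : L, S.inH X → S.psi X = 0 → X = 0) ∧
      (∀ Y : L, S.inH Y → ∃ X : L, S.inH X ∧ S.psi X = Y)) := by
  by_cases h : ∃ X, S.inH X ∧ X ≠ 0 ∧ S.psi X = 0
  · obtain ⟨X, hX, hX0, hψ⟩ := h
    exact Or.inl fun Y hY => S.psi_eq_zero_of_finrank_eq_seven hdim hX hX0 hψ hY
  · have hinj : ∀ X : L, S.inH X → S.psi X = 0 → X = 0 := fun X hX hψ => by
      by_contra hX0
      exact h ⟨X, hX, hX0, hψ⟩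
    refine Or.inr ⟨hinj, fun Y hY => ?_⟩
    let ψ : S.H →ₗ[ℝ] S.H :=
      S.psi.restrict fun X hX => S.mem_H.mpr (S.psi_inH (S.mem_H.mp hX))
    have hψ : Function.Injective ψ := (injective_iff_map_eq_zero ψ).mpr fun X hX =>
      Subtype.ext (hinj X (S.mem_H.mp X.2) (congrArg Subtype.val hX))
    obtain ⟨X, hX⟩ := LinearMap.surjective_of_injective hψ ⟨Y, S.mem_H.mpr hY⟩
    exact ⟨X, S.mem_H.mp X.2, congrArg Subtype.val hX⟩
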